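/- Let d ≥ 2, δ > 0 with δ < 1/(2d), and α > 1. Then for any initial condition, the occupation-measure process z(n) of the two-particle vertex-reinforced interacting random walk satisfies P( lim_{n→∞} z(n) = (U,U) ) = 0, where U = (1/d, …, 1/d) ∈ ℝ^d. -/

import Mathlib

open MeasureTheory Filter Finset

/-- `π_i(x) = f_δ(x_i)^{−α} / ∑_k f_δ(x_k)^{−α}` with `f_δ(x) = max(δ, x)`. -/
noncomputable def piv (d : ℕ) (δ α : ℝ) (x : Fin d → ℝ) (i : Fin d) : ℝ :=
  (max δ (x i)) ^ (-α) / ∑ k, (max δ (x k)) ^ (-α)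

/-- The empirical occupation measure: `occ d X n ω i = (1 + #{1 ≤ k ≤ n : X_k(ω) = i})/(n+d)`. -/
noncomputable def occ {Ω : Type} (d : ℕ) (X : ℕ → Ω → Fin d) (n : ℕ) (ω : Ω) (i : Fin d) : ℝ :=
  (1 + ((Finset.Icc 1 n).filter (fun k => X k ω = i)).card) / (n + d)

lemma hasStrictDerivAt_max_rpow_neg {δ α t : ℝ} (hδ : 0 < δ) (ht : δ < t) :
    HasStrictDerivAt (fun s : ℝ => (max δ s) ^ (-α)) (-α * t ^ (-α - 1)) t := by
  have h := Real.hasStrictDerivAt_rpow_const_of_ne (hδ.trans ht).ne' (-α)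
  refine h.congr_of_eventuallyEq ?_
  filter_upwards [lt_mem_nhds ht] with s hs
  rw [max_eq_right hs.le]

lemma sum_max_rpow_pos {d : ℕ} (hd : 0 < d) {δ : ℝ} (hδ : 0 < δ) (α : ℝ) (x : Fin d → ℝ) :
    0 < ∑ k, (max δ (x k)) ^ (-α) := by
  have : Nonempty (Fin d) := ⟨⟨0, hd⟩⟩
  exact Finset.sum_pos (fun k _ => Real.rpow_pos_of_pos (lt_max_of_lt_left hδ) _)
    Finset.univ_nonempty

lemma piv_nonneg {d : ℕ} {δ : ℝ} (hδ : 0 < δ) (α : ℝ) (x : Fin d → ℝ) (i : Fin d) :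
    0 ≤ piv d δ α x i :=
  div_nonneg (Real.rpow_nonneg (le_max_of_le_left hδ.le) _)
    (Finset.sum_nonneg fun _ _ => Real.rpow_nonneg (le_max_of_le_left hδ.le) _)

lemma sum_piv {d : ℕ} (hd : 0 < d) {δ : ℝ} (hδ : 0 < δ) (α : ℝ) (x : Fin d → ℝ) :
    ∑ i, piv d δ α x i = 1 := by
  simp only [piv]
  rw [← Finset.sum_div, div_self (sum_max_rpow_pos hd hδ α x).ne']

/-- The strict derivative of `piv` at the uniform distribution, evaluated on vectors of zero sum,
is multiplication by `-α`. -/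
lemma piv_hasStrictFDerivAt_uniform {d : ℕ} (hd : 0 < d) {δ : ℝ} (hδ : 0 < δ)
    (hδ' : δ < 1 / (d : ℝ)) (α : ℝ) (i : Fin d) :
    ∃ L : (Fin d → ℝ) →L[ℝ] ℝ,
      HasStrictFDerivAt (fun x => piv d δ α x i) L (fun _ => 1 / (d : ℝ)) ∧
      ∀ v : Fin d → ℝ, ∑ k, v k = 0 → L v = -α * v i := by
  have hd' : (0 : ℝ) < d := by exact_mod_cast hd
  have ht : (0 : ℝ) < 1 / d := by positivity
  have hk : ∀ k : Fin d, HasStrictFDerivAt (fun x : Fin d → ℝ => (max δ (x k)) ^ (-α))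
      ((-α * (1 / (d : ℝ)) ^ (-α - 1)) • ContinuousLinearMap.proj (R := ℝ) k)
      (fun _ => 1 / (d : ℝ)) := fun k =>
    HasStrictDerivAt.comp_hasStrictFDerivAt (f := fun x : Fin d → ℝ => x k)
      (h₂ := fun s : ℝ => (max δ s) ^ (-α)) (fun _ : Fin d => 1 / (d : ℝ))
      (hasStrictDerivAt_max_rpow_neg hδ hδ') (hasStrictFDerivAt_apply (𝕜 := ℝ) k _)
  have hs := HasStrictFDerivAt.fun_sum (u := Finset.univ) fun k _ => hk k
  have hZ := (sum_max_rpow_pos hd hδ α (fun _ => 1 / (d : ℝ))).ne'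
  have hinv := (hasStrictDerivAt_inv hZ).comp_hasStrictFDerivAt (fun _ : Fin d => 1 / (d : ℝ)) hs
  refine ⟨_, (hk i).mul hinv, fun v hv => ?_⟩
  have h0 : (1 / (d : ℝ)) ^ (-α) ≠ 0 := (Real.rpow_pos_of_pos ht _).ne'
  have hsub : (1 / (d : ℝ)) ^ (-α - 1) = (1 / (d : ℝ)) ^ (-α) * d := by
    rw [Real.rpow_sub_one ht.ne']; field_simp
  simp [max_eq_right hδ'.le, ← Finset.mul_sum, hv, -one_div, hsub]
  field_simp

lemma exists_ball_uniform_repelling {d : ℕ} (hd : 2 ≤ d) {δ : ℝ} (hδ : 0 < δ)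
    (hδ' : δ < 1 / (d : ℝ)) {α : ℝ} (hα : 1 < α) :
    ∃ V ∈ nhds (fun _ : Fin d => 1 / (d : ℝ)), ∀ x ∈ V, ∀ y ∈ V, ∑ i, x i = 1 → ∑ i, y i = 1 →
      ∑ i, (x i - y i) ^ 2 ≤ ∑ i, (x i - y i) * (piv d δ α y i - piv d δ α x i) ∧
      ∑ i, piv d δ α y i * piv d δ α x i ≤ 3 / 4 := by
  have hd0 : 0 < d := by omega
  have hd' : (2 : ℝ) ≤ d := by exact_mod_cast hd
  choose L hL hLv using piv_hasStrictFDerivAt_uniform hd0 hδ hδ' α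
  have hε : 0 < (α - 1) / d := div_pos (by linarith) (by linarith)
  have h1 : ∀ᶠ p : (Fin d → ℝ) × (Fin d → ℝ) in
      nhds ((fun _ => 1 / (d : ℝ)), (fun _ => 1 / (d : ℝ))), ∀ i,
      ‖piv d δ α p.1 i - piv d δ α p.2 i - L i (p.1 - p.2)‖ ≤ (α - 1) / d * ‖p.1 - p.2‖ :=
    eventually_all.2 fun i => (hL i).isLittleO.bound hε
  have hU : ∀ i : Fin d, piv d δ α (fun _ => 1 / (d : ℝ)) i < 3 / 4 := by
    intro i
    have h0 : (1 / (d : ℝ)) ^ (-α) ≠ 0 := (Real.rpow_pos_of_pos (by positivity) _).ne'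
    simp only [piv, max_eq_right hδ'.le, Finset.sum_const, Finset.card_univ, Fintype.card_fin,
      nsmul_eq_mul]
    rw [div_lt_iff₀ (by positivity)]
    have : 0 < (1 / (d : ℝ)) ^ (-α) := by positivity
    nlinarith
  have h2 : ∀ᶠ x in nhds (fun _ : Fin d => 1 / (d : ℝ)), ∀ i, piv d δ α x i < 3 / 4 :=
    eventually_all.2 fun i => (hL i).continuousAt.eventually_lt_const (hU i)
  rw [nhds_prod_eq] at h1
  obtain ⟨V, hV, hVp⟩ := eventually_prod_self_iff'.1 h1
  refine ⟨V ∩ {x | ∀ i, piv d δ α x i < 3 / 4}, inter_mem hV h2, ?_⟩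
  rintro x ⟨hx, -⟩ y ⟨hy, hy2⟩ hxs hys
  constructor
  · have hn : ∀ i, |x i - y i| ≤ ‖y - x‖ := fun i => by
      rw [abs_sub_comm]; exact norm_le_pi_norm (y - x) i
    have hsq : ‖y - x‖ ^ 2 ≤ ∑ i, (x i - y i) ^ 2 := by
      have : Nonempty (Fin d) := ⟨⟨0, hd0⟩⟩
      obtain ⟨j, hj⟩ := Finite.exists_max fun i => ‖(y - x) i‖
      have : ‖y - x‖ ≤ ‖(y - x) j‖ := (pi_norm_le_iff_of_nonneg (norm_nonneg _)).2 hj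
      calc ‖y - x‖ ^ 2 ≤ ‖(y - x) j‖ ^ 2 := by gcongr
        _ = (x j - y j) ^ 2 := by
          rw [Real.norm_eq_abs, sq_abs, Pi.sub_apply]; ring
        _ ≤ _ := Finset.single_le_sum (f := fun i => (x i - y i) ^ 2)
          (fun i _ => sq_nonneg _) (Finset.mem_univ j)
    have hterm : ∀ i, α * (x i - y i) ^ 2 - (α - 1) / d * ‖y - x‖ ^ 2 ≤
        (x i - y i) * (piv d δ α y i - piv d δ α x i) := by
      intro i
      have h := hVp y hy x hx i
      simp only at h
      rw [hLv i (y - x) (by simp [hxs, hys])] at h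
      have h3 : |(x i - y i) * (piv d δ α y i - piv d δ α x i - -α * (y - x) i)| ≤
          ‖y - x‖ * ((α - 1) / d * ‖y - x‖) := by
        rw [abs_mul]
        exact mul_le_mul (hn i) h (abs_nonneg _) (norm_nonneg _)
      have h4 := (abs_le.1 h3).1
      simp only [Pi.sub_apply] at h4
      nlinarith
    have hsum := Finset.sum_le_sum fun i (_ : i ∈ Finset.univ) => hterm i
    rw [Finset.sum_sub_distrib, ← Finset.mul_sum, Finset.sum_const, Finset.card_univ,
      Fintype.card_fin, nsmul_eq_mul] at hsum
    have : (d : ℝ) * ((α - 1) / d * ‖y - x‖ ^ 2) = (α - 1) * ‖y - x‖ ^ 2 := by field_simp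
    nlinarith
  · calc ∑ i, piv d δ α y i * piv d δ α x i ≤ ∑ i, 3 / 4 * piv d δ α x i :=
        Finset.sum_le_sum fun i _ =>
          mul_le_mul_of_nonneg_right (hy2 i).le (piv_nonneg hδ α x i)
      _ = 3 / 4 := by rw [← Finset.mul_sum, sum_piv hd0 hδ, mul_one]

/-- The Lyapunov function, in terms of `N = n + d` and of the squared norm `Q` of the difference of
the two occupation vectors. -/
noncomputable def lyap (N Q : ℝ) : ℝ :=
  2 * Real.log N - Real.log (Q + 64 * N) + 24576 * (N / (Q + 64 * N))

/-- The slope of an affine upper bound for the increment of `lyap`. -/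
noncomputable def lyapSlope (N Q : ℝ) : ℝ :=
  1 / (Q + 64 * N) + 24576 * ((N + 1) / (Q + 64 * N) ^ 2)

/-- The constant term of an affine upper bound for the increment of `lyap`. -/
noncomputable def lyapConst (N Q : ℝ) : ℝ :=
  2 / N + 2 * (16 * Q + 8712) / (Q + 64 * N) ^ 2 +
    24576 * ((N + 1) / (Q + 64 * N) * (1 + 2 * (16 * Q + 8712) / (Q + 64 * N) ^ 2)
      - N / (Q + 64 * N))

lemma lyapSlope_nonneg {N Q : ℝ} (hN : 0 ≤ N) (hQ : 0 ≤ Q) : 0 ≤ lyapSlope N Q := by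
  unfold lyapSlope; positivity

lemma lyap_step_le {N Q D : ℝ} (hN : 8712 ≤ N) (hQ : 0 ≤ Q) (hD : D ^ 2 ≤ 16 * Q + 8712) :
    lyap (N + 1) (Q + D - 64) - lyap N Q ≤ lyapConst N Q - lyapSlope N Q * D := by
  set R := Q + 64 * N with hR
  have hN0 : 0 < N := by linarith
  have hRN : 64 * N ≤ R := by linarith
  have hR0 : 0 < R := by linarith
  have hDR : -(R / 2) ≤ D := by
    refine neg_le_of_abs_le (abs_le_of_sq_le_sq ?_ (by linarith))
    nlinarith
  have hR' : Q + D - 64 + 64 * (N + 1) = R + D := by rw [hR]; ring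
  have hRD : 0 < R + D := by linarith
  have key : R / (R + D) ≤ 1 - D / R + 2 * (16 * Q + 8712) / R ^ 2 := by
    have h1 : R / (R + D) ≤ 1 - D / R + 2 * D ^ 2 / R ^ 2 := by
      rw [div_le_iff₀ hRD]
      have : (1 - D / R + 2 * D ^ 2 / R ^ 2) * (R + D) - R = D ^ 2 * (R + 2 * D) / R ^ 2 := by
        field_simp; ring
      have h2 : 0 ≤ D ^ 2 * (R + 2 * D) / R ^ 2 :=
        div_nonneg (mul_nonneg (sq_nonneg _) (by linarith)) (sq_nonneg _)
      linarith
    have : 2 * D ^ 2 / R ^ 2 ≤ 2 * (16 * Q + 8712) / R ^ 2 := by gcongr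
    linarith
  have hlogR : Real.log R - Real.log (R + D) ≤ R / (R + D) - 1 := by
    rw [← Real.log_div hR0.ne' hRD.ne']
    exact Real.log_le_sub_one_of_pos (by positivity)
  have hlogN : Real.log (N + 1) - Real.log N ≤ 1 / N := by
    rw [← Real.log_div (by linarith) hN0.ne']
    refine (Real.log_le_sub_one_of_pos (by positivity)).trans_eq ?_
    field_simp; ring
  have hfrac : (N + 1) / (R + D) ≤
      (N + 1) / R * (1 - D / R + 2 * (16 * Q + 8712) / R ^ 2) := by
    calc (N + 1) / (R + D) = (N + 1) / R * (R / (R + D)) := by field_simp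
      _ ≤ _ := by gcongr
  unfold lyap lyapConst lyapSlope
  rw [hR', ← hR]
  have e1 : (1 / R + 24576 * ((N + 1) / R ^ 2)) * D
      = D / R + 24576 * ((N + 1) / R * (D / R)) := by field_simp
  have e2 : 2 / N = 2 * (1 / N) := by ring
  rw [e1, e2]
  linarith

lemma lyapConst_le_slope_mul {N Q e : ℝ} (hN : 8712 ≤ N) (hQ : 0 ≤ Q)
    (he : 2 * (Q / N) + 64 + 1 / 2 ≤ e) : lyapConst N Q ≤ lyapSlope N Q * e := by
  have hN0 : 0 < N := by linarith
  refine le_trans ?_ (mul_le_mul_of_nonneg_left he (lyapSlope_nonneg hN0.le hQ))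
  obtain ⟨q, rfl⟩ : ∃ q, Q = q * N := ⟨Q / N, by field_simp⟩
  have hq : 0 ≤ q := by by_contra h; nlinarith
  rw [mul_div_cancel_right₀ _ hN0.ne']
  set r := q + 64 with hr
  have hr0 : 0 < r := by linarith
  have hR : q * N + 64 * N = r * N := by rw [hr]; ring
  set m := 2 * (16 * q + 1) with hm
  have hM : 2 * (16 * (q * N) + 8712) / (r * N) ^ 2 ≤ m / (N * r ^ 2) := by
    rw [div_le_div_iff₀ (by positivity) (by positivity), hm]
    have : 2 * (16 * (q * N) + 8712) ≤ 2 * (16 * q + 1) * N := by nlinarith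
    calc _ ≤ 2 * (16 * q + 1) * N * (N * r ^ 2) := by gcongr
      _ = _ := by ring
  unfold lyapConst lyapSlope
  rw [hR]
  have hA : 2 / N + 2 * (16 * (q * N) + 8712) / (r * N) ^ 2 +
      24576 * ((N + 1) / (r * N) * (1 + 2 * (16 * (q * N) + 8712) / (r * N) ^ 2) - N / (r * N))
      ≤ 2 / N + m / (N * r ^ 2) +
      24576 * ((N + 1) / (r * N) * (1 + m / (N * r ^ 2)) - N / (r * N)) := by gcongr
  refine hA.trans ?_
  have hid : (1 / (r * N) + 24576 * ((N + 1) / (r * N) ^ 2)) * (2 * q + 64 + 1 / 2) -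
      (2 / N + m / (N * r ^ 2) +
        24576 * ((N + 1) / (r * N) * (1 + m / (N * r ^ 2)) - N / (r * N))) =
      ((r * (2 * q + 64 + 1 / 2) - 2 * r ^ 2 - m) * r +
        24576 * ((r * (2 * q + 64 + 1 / 2) - r ^ 2 - m)
          + (r * (2 * q + 64 + 1 / 2) - m) / N)) / (N * r ^ 3) := by
    field_simp; ring
  have hnum : 0 ≤ (r * (2 * q + 64 + 1 / 2) - 2 * r ^ 2 - m) * r +
        24576 * ((r * (2 * q + 64 + 1 / 2) - r ^ 2 - m)
          + (r * (2 * q + 64 + 1 / 2) - m) / N) := by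
    have h1 : 0 ≤ (r * (2 * q + 64 + 1 / 2) - m) / N := by
      apply div_nonneg _ hN0.le
      rw [hr, hm]; nlinarith
    have h2 : 0 ≤ (r * (2 * q + 64 + 1 / 2) - 2 * r ^ 2 - m) * r +
        24576 * (r * (2 * q + 64 + 1 / 2) - r ^ 2 - m) := by
      rw [hr, hm]; ring_nf; positivity
    linarith
  have := div_nonneg hnum (by positivity : 0 ≤ N * r ^ 3)
  linarith

lemma lyap_bounded_below {N Q a : ℝ} (hN : 1 ≤ N) (ha : 0 ≤ a) (hQ : 0 ≤ Q)
    (hQN : Q ≤ a * N ^ 2) : 0 ≤ lyap N Q + Real.log (a + 64) := by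
  have hN0 : 0 < N := by linarith
  have h1 : Real.log (Q + 64 * N) ≤ Real.log ((a + 64) * N ^ 2) :=
    Real.log_le_log (by positivity) (by nlinarith)
  rw [Real.log_mul (by positivity) (by positivity), Real.log_pow] at h1
  have h2 : 0 ≤ 24576 * (N / (Q + 64 * N)) := by positivity
  unfold lyap
  push_cast at h1
  linarith

lemma tendsto_lyap_atTop {N Q : ℕ → ℝ} (hN : Tendsto N atTop atTop) (hQ : ∀ n, 0 ≤ Q n)
    (h : Tendsto (fun n => Q n / N n ^ 2) atTop (nhds 0)) :
    Tendsto (fun n => lyap (N n) (Q n)) atTop atTop := by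
  have h1 : Tendsto (fun n => Q n / N n ^ 2 + 64 * (N n)⁻¹) atTop (nhds 0) := by
    simpa using h.add ((tendsto_inv_atTop_zero.comp hN).const_mul 64)
  have h2 : Tendsto (fun n => Q n / N n ^ 2 + 64 * (N n)⁻¹) atTop (nhdsWithin 0 (Set.Ioi 0)) := by
    refine tendsto_nhdsWithin_iff.2 ⟨h1, ?_⟩
    filter_upwards [hN.eventually_gt_atTop 0] with n hn
    have := hQ n
    exact Set.mem_Ioi.2 (by positivity)
  have h3 := tendsto_neg_atBot_atTop.comp (Real.tendsto_log_nhdsGT_zero.comp h2)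
  refine tendsto_atTop_mono' _ ?_ h3
  filter_upwards [hN.eventually_gt_atTop 0] with n hn
  have hQn := hQ n
  have e : Q n / N n ^ 2 + 64 * (N n)⁻¹ = (Q n + 64 * N n) / N n ^ 2 := by field_simp
  simp only [Function.comp, e]
  rw [Real.log_div (by positivity) (by positivity), Real.log_pow]
  have : 0 ≤ 24576 * (N n / (Q n + 64 * N n)) := by positivity
  unfold lyap
  push_cast
  linarith

section Occupation

variable {Ω : Type} {d : ℕ}

lemma add_mul_occ (hd : 0 < d) (X : ℕ → Ω → Fin d) (n : ℕ) (ω : Ω) (i : Fin d) :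
    ((n : ℝ) + d) * occ d X n ω i = 1 + ((Finset.Icc 1 n).filter (fun k => X k ω = i)).card := by
  have : (0 : ℝ) < d := by exact_mod_cast hd
  rw [occ, mul_div_cancel₀ _ (by positivity)]

lemma sum_occ (hd : 0 < d) (X : ℕ → Ω → Fin d) (n : ℕ) (ω : Ω) : ∑ i, occ d X n ω i = 1 := by
  have hd' : (0 : ℝ) < d := by exact_mod_cast hd
  have hN : ((n : ℝ) + d) ≠ 0 := by positivity
  apply mul_left_cancel₀ hN
  simp_rw [Finset.mul_sum, add_mul_occ hd, Finset.sum_add_distrib]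
  have h := Finset.card_eq_sum_card_fiberwise (f := fun k => X k ω) (s := Finset.Icc 1 n)
    (t := Finset.univ) (fun _ _ => by simp)
  rw [← Nat.cast_sum, ← h]
  simp [add_comm]

lemma add_mul_occ_succ (hd : 0 < d) (X : ℕ → Ω → Fin d) (n : ℕ) (ω : Ω) (i : Fin d) :
    (((n + 1 : ℕ) : ℝ) + d) * occ d X (n + 1) ω i =
      ((n : ℝ) + d) * occ d X n ω i + if X (n + 1) ω = i then 1 else 0 := by
  rw [add_mul_occ hd, add_mul_occ hd, ← Finset.insert_Icc_right_eq_Icc_add_one (by omega),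
    Finset.filter_insert]
  split_ifs
  · rw [Finset.card_insert_of_notMem (by simp)]
    push_cast; ring
  · simp

/-- The difference of the (unnormalised) occupation vectors of `X` and `Y`. -/
noncomputable def gap (d : ℕ) (X Y : ℕ → Ω → Fin d) (n : ℕ) (ω : Ω) (i : Fin d) : ℝ :=
  ((n : ℝ) + d) * (occ d X n ω i - occ d Y n ω i)

/-- The squared Euclidean norm of `gap`. -/
noncomputable def sqGap (d : ℕ) (X Y : ℕ → Ω → Fin d) (n : ℕ) (ω : Ω) : ℝ :=
  ∑ i, gap d X Y n ω i ^ 2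

/-- The increment of `sqGap`, shifted by `64`, when the walks move to `i` and `j`. -/
noncomputable def sqGapStep (g : Fin d → ℝ) (i j : Fin d) : ℝ :=
  64 + 2 * (g i - g j) + (2 - 2 * if i = j then 1 else 0)

lemma sqGap_nonneg (X Y : ℕ → Ω → Fin d) (n : ℕ) (ω : Ω) : 0 ≤ sqGap d X Y n ω :=
  Finset.sum_nonneg fun _ _ => sq_nonneg _

lemma sqGap_succ (hd : 0 < d) (X Y : ℕ → Ω → Fin d) (n : ℕ) (ω : Ω) :
    sqGap d X Y (n + 1) ω =
      sqGap d X Y n ω + sqGapStep (gap d X Y n ω) (X (n + 1) ω) (Y (n + 1) ω) - 64 := by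
  have hg : ∀ i, gap d X Y (n + 1) ω i = gap d X Y n ω i +
      ((if X (n + 1) ω = i then 1 else 0) - (if Y (n + 1) ω = i then 1 else 0)) := by
    intro i
    rw [gap, gap, mul_sub, mul_sub, add_mul_occ_succ hd, add_mul_occ_succ hd]
    ring
  have hexp : ∀ i, gap d X Y (n + 1) ω i ^ 2 = gap d X Y n ω i ^ 2 +
      (2 * (if X (n + 1) ω = i then gap d X Y n ω i else 0)
        - 2 * (if Y (n + 1) ω = i then gap d X Y n ω i else 0)
        + (if X (n + 1) ω = i then 1 else 0) + (if Y (n + 1) ω = i then 1 else 0)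
        - 2 * (if X (n + 1) ω = i then (if Y (n + 1) ω = i then 1 else 0) else 0)) := by
    intro i
    rw [hg]
    split_ifs <;> ring
  rw [sqGap, Finset.sum_congr rfl fun i _ => hexp i]
  simp only [Finset.sum_add_distrib, Finset.sum_sub_distrib, ← Finset.mul_sum,
    Finset.sum_ite_eq, Finset.mem_univ, if_true, sqGapStep, sqGap]
  simp only [eq_comm (a := Y (n + 1) ω)]
  ring

lemma sqGapStep_sq_le (g : Fin d → ℝ) (i j : Fin d) :
    sqGapStep g i j ^ 2 ≤ 16 * ∑ k, g k ^ 2 + 8712 := by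
  have h0 : 0 ≤ ∑ k, g k ^ 2 := Finset.sum_nonneg fun _ _ => sq_nonneg _
  by_cases h : i = j
  · subst h
    simp [sqGapStep]
    linarith
  · have h2 : g i ^ 2 + g j ^ 2 ≤ ∑ k, g k ^ 2 := by
      rw [← Finset.sum_pair (f := fun k => g k ^ 2) h]
      exact Finset.sum_le_sum_of_subset_of_nonneg (Finset.subset_univ _)
        fun _ _ _ => sq_nonneg _
    simp only [sqGapStep, h, if_false]
    nlinarith [sq_nonneg (g i + g j), sq_nonneg (2 * (g i - g j) - 66)]

lemma sqGap_le (X Y : ℕ → Ω → Fin d) (hd : 0 < d) (n : ℕ) (ω : Ω) :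
    sqGap d X Y n ω ≤ d * ((n : ℝ) + d) ^ 2 := by
  have hd' : (0 : ℝ) < d := by exact_mod_cast hd
  have hocc : ∀ (Z : ℕ → Ω → Fin d) i, 0 ≤ occ d Z n ω i := fun Z i => by
    unfold occ; positivity
  have hle : ∀ (Z : ℕ → Ω → Fin d) i, occ d Z n ω i ≤ 1 := fun Z i => by
    rw [← sum_occ hd Z n ω]
    exact Finset.single_le_sum (fun k _ => hocc Z k) (Finset.mem_univ i)
  calc sqGap d X Y n ω ≤ ∑ _i : Fin d, ((n : ℝ) + d) ^ 2 := by
        refine Finset.sum_le_sum fun i _ => ?_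
        rw [gap, mul_pow]
        refine mul_le_of_le_one_right (by positivity) ?_
        rw [sq_le_one_iff_abs_le_one, abs_le]
        constructor <;> linarith [hocc X i, hocc Y i, hle X i, hle Y i]
    _ = _ := by simp

lemma sum_sqGapStep_mul {p q : Fin d → ℝ} (hp : ∑ i, p i = 1) (hq : ∑ i, q i = 1)
    (g : Fin d → ℝ) :
    ∑ i, ∑ j, sqGapStep g i j * (p i * q j) =
      66 + 2 * ∑ i, g i * (p i - q i) - 2 * ∑ i, p i * q i := by
  have h : ∀ i j, sqGapStep g i j * (p i * q j) =
      66 * (p i * q j) + 2 * (g i * p i * q j) - 2 * (p i * (g j * q j))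
        - 2 * (if i = j then p i * q j else 0) := by
    intro i j
    unfold sqGapStep
    split_ifs <;> ring
  simp only [h, Finset.sum_add_distrib, Finset.sum_sub_distrib, ← Finset.mul_sum, hq, mul_one,
    ← Finset.sum_mul, hp, one_mul, Finset.sum_ite_eq, Finset.mem_univ, if_true, mul_sub]
  ring

/-- `f` is a function of the trajectories of `X` and `Y` up to time `n`. -/
def DependsOnPast (X Y : ℕ → Ω → Fin d) (n : ℕ) (f : Ω → ℝ) : Prop :=
  ∀ ω ω', (∀ k ≤ n, X k ω = X k ω' ∧ Y k ω = Y k ω') → f ω = f ω'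

lemma occ_congr {X : ℕ → Ω → Fin d} {n : ℕ} {ω ω' : Ω} (h : ∀ k ≤ n, X k ω = X k ω') :
    occ d X n ω = occ d X n ω' := by
  funext i
  unfold occ
  congr 4
  exact Finset.filter_congr fun k hk => by rw [h k (Finset.mem_Icc.1 hk).2]

lemma DependsOnPast.of_occ {X Y : ℕ → Ω → Fin d} {n : ℕ}
    (F : (ℕ → (Fin d → ℝ) × (Fin d → ℝ)) → ℝ)
    (hF : ∀ z z', (∀ k ≤ n, z k = z' k) → F z = F z') :
    DependsOnPast X Y n (fun ω => F fun k => (occ d X k ω, occ d Y k ω)) := by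
  intro ω ω' h
  refine hF _ _ fun k hk => ?_
  exact Prod.ext (occ_congr fun l hl => (h l (hl.trans hk)).1)
    (occ_congr fun l hl => (h l (hl.trans hk)).2)

lemma DependsOnPast.stronglyMeasurable_and_bounded {mΩ : MeasurableSpace Ω}
    {ℱ : Filtration ℕ mΩ} {X Y : ℕ → Ω → Fin d} (hX : ∀ n, Measurable[ℱ n] (X n))
    (hY : ∀ n, Measurable[ℱ n] (Y n)) {n : ℕ} {f : Ω → ℝ} (hf : DependsOnPast X Y n f) :
    StronglyMeasurable[ℱ n] f ∧ ∃ C, ∀ ω, ‖f ω‖ ≤ C := by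
  let H : Ω → Fin (n + 1) → Fin d × Fin d := fun ω k => (X k ω, Y k ω)
  have hH : Measurable[ℱ n] H := by
    refine @measurable_pi_lambda _ _ _ (ℱ n) _ _ fun k => ?_
    have hk : (k : ℕ) ≤ n := Nat.lt_succ_iff.1 k.2
    have hXk : Measurable[ℱ n] (X k) := (hX k).mono (ℱ.mono hk) le_rfl
    have hYk : Measurable[ℱ n] (Y k) := (hY k).mono (ℱ.mono hk) le_rfl
    exact hXk.prodMk hYk
  have hfac : Function.FactorsThrough f H := fun ω ω' h => hf ω ω' fun k hk => by
    have := congrFun h ⟨k, Nat.lt_succ_iff.2 hk⟩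
    exact ⟨congrArg Prod.fst this, congrArg Prod.snd this⟩
  have hfe : f = Function.extend H f 0 ∘ H := (hfac.extend_comp _).symm
  constructor
  · rw [hfe]
    exact ((measurable_of_finite _).comp hH).stronglyMeasurable
  · obtain ⟨C, hC⟩ := (Set.finite_range fun h => ‖Function.extend H f 0 h‖).bddAbove
    refine ⟨C, fun ω => ?_⟩
    rw [hfe]
    exact hC ⟨H ω, rfl⟩

lemma DependsOnPast.integrable {mΩ : MeasurableSpace Ω} {P : Measure Ω} [IsFiniteMeasure P]
    {ℱ : Filtration ℕ mΩ} {X Y : ℕ → Ω → Fin d} (hX : ∀ n, Measurable[ℱ n] (X n))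
    (hY : ∀ n, Measurable[ℱ n] (Y n)) {n : ℕ} {f : Ω → ℝ} (hf : DependsOnPast X Y n f) :
    Integrable f P := by
  obtain ⟨h1, C, hC⟩ := hf.stronglyMeasurable_and_bounded hX hY
  exact .of_bound (h1.mono (ℱ.le n)).aestronglyMeasurable C (ae_of_all _ hC)

end Occupation

lemma integral_mul_eq_of_condExp_ae_eq {Ω : Type*} {m mΩ : MeasurableSpace Ω} {P : Measure Ω}
    [IsFiniteMeasure P] (hm : m ≤ mΩ) {f g p : Ω → ℝ} (hf : StronglyMeasurable[m] f) {C : ℝ}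
    (hC : ∀ ω, ‖f ω‖ ≤ C) (hg : Integrable g P) (hp : P[g | m] =ᵐ[P] p) :
    ∫ ω, f ω * g ω ∂P = ∫ ω, f ω * p ω ∂P := by
  have hfg : Integrable (f * g) P :=
    hg.bdd_mul (hf.mono hm).aestronglyMeasurable (ae_of_all _ hC)
  have h := condExp_mul_of_stronglyMeasurable_left hf hfg hg
  calc ∫ ω, f ω * g ω ∂P = ∫ ω, (P[f * g | m]) ω ∂P := (integral_condExp hm).symm
    _ = ∫ ω, f ω * p ω ∂P := by
      refine integral_congr_ae ?_
      filter_upwards [h, hp] with ω h1 h2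
      rw [h1, Pi.mul_apply, h2]

section Walk

variable {Ω : Type} {d : ℕ} {δ α : ℝ}

open Classical in
/-- The indicator that both occupation measures stay in `V` during the times `m, …, n`. -/
noncomputable def confined (d : ℕ) (X Y : ℕ → Ω → Fin d) (V : Set (Fin d → ℝ)) (m n : ℕ)
    (ω : Ω) : ℝ :=
  if ∀ k, m ≤ k → k ≤ n → occ d X k ω ∈ V ∧ occ d Y k ω ∈ V then 1 else 0

lemma confined_nonneg (X Y : ℕ → Ω → Fin d) (V : Set (Fin d → ℝ)) (m n : ℕ) (ω : Ω) :
    0 ≤ confined d X Y V m n ω := by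
  unfold confined; split_ifs <;> norm_num

lemma confined_succ_le (X Y : ℕ → Ω → Fin d) (V : Set (Fin d → ℝ)) (m n : ℕ) (ω : Ω) :
    confined d X Y V m (n + 1) ω ≤ confined d X Y V m n ω := by
  unfold confined
  split_ifs with h1 h2 <;> norm_num
  exact absurd (fun k hk hk' => h1 k hk (hk'.trans n.le_succ)) h2

lemma dependsOnPast_confined_mul (X Y : ℕ → Ω → Fin d) (V : Set (Fin d → ℝ)) (m n : ℕ)
    (F : (Fin d → ℝ) → (Fin d → ℝ) → ℝ) :
    DependsOnPast X Y n
      (fun ω => confined d X Y V m n ω * F (occ d X n ω) (occ d Y n ω)) := by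
  classical
  refine DependsOnPast.of_occ (fun z => (if ∀ k, m ≤ k → k ≤ n → (z k).1 ∈ V ∧ (z k).2 ∈ V
    then 1 else 0) * F (z n).1 (z n).2) fun z z' h => ?_
  have hiff : (∀ k, m ≤ k → k ≤ n → (z k).1 ∈ V ∧ (z k).2 ∈ V) ↔
      (∀ k, m ≤ k → k ≤ n → (z' k).1 ∈ V ∧ (z' k).2 ∈ V) :=
    forall_congr' fun k => forall_congr' fun _ => forall_congr' fun hk => by rw [h k hk]
  simp only [hiff, h n le_rfl]

/-- The nonnegative Lyapunov process of the two walks. -/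
noncomputable def lyapProc (d : ℕ) (X Y : ℕ → Ω → Fin d) (n : ℕ) (ω : Ω) : ℝ :=
  lyap ((n : ℝ) + d) (sqGap d X Y n ω) + Real.log (d + 64)

lemma lyapProc_nonneg (hd : 0 < d) (X Y : ℕ → Ω → Fin d) (n : ℕ) (ω : Ω) :
    0 ≤ lyapProc d X Y n ω := by
  have hd' : (1 : ℝ) ≤ d := by exact_mod_cast hd
  have hn : (0 : ℝ) ≤ n := n.cast_nonneg
  exact lyap_bounded_below (by linarith) (by linarith) (sqGap_nonneg X Y n ω)
    (sqGap_le X Y hd n ω)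

lemma lyapProc_succ_le (hd : 0 < d) (X Y : ℕ → Ω → Fin d) {n : ℕ} (hn : 8712 ≤ n) (ω : Ω) :
    lyapProc d X Y (n + 1) ω ≤ lyapProc d X Y n ω +
      (lyapConst ((n : ℝ) + d) (sqGap d X Y n ω) - lyapSlope ((n : ℝ) + d) (sqGap d X Y n ω) *
        sqGapStep (gap d X Y n ω) (X (n + 1) ω) (Y (n + 1) ω)) := by
  have hn' : (8712 : ℝ) ≤ n := by exact_mod_cast hn
  have h := lyap_step_le (N := (n : ℝ) + d) (by linarith [(d.cast_nonneg : (0 : ℝ) ≤ d)])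
    (sqGap_nonneg X Y n ω)
    (sqGapStep_sq_le (gap d X Y n ω) (X (n + 1) ω) (Y (n + 1) ω))
  rw [← sqGap_succ hd] at h
  have e : ((n + 1 : ℕ) : ℝ) + d = (n : ℝ) + d + 1 := by push_cast; ring
  rw [lyapProc, lyapProc, e]
  linarith

/-- Inside a repelling neighbourhood the affine bound for the increment of `lyapProc` has
nonpositive mean. -/
lemma lyapConst_le_mean (hd : 0 < d) (hδ : 0 < δ) {V : Set (Fin d → ℝ)}
    (hV : ∀ x ∈ V, ∀ y ∈ V, ∑ i, x i = 1 → ∑ i, y i = 1 →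
      ∑ i, (x i - y i) ^ 2 ≤ ∑ i, (x i - y i) * (piv d δ α y i - piv d δ α x i) ∧
      ∑ i, piv d δ α y i * piv d δ α x i ≤ 3 / 4)
    (X Y : ℕ → Ω → Fin d) {n : ℕ} (hn : 8712 ≤ n) {ω : Ω} (hX : occ d X n ω ∈ V)
    (hY : occ d Y n ω ∈ V) :
    lyapConst ((n : ℝ) + d) (sqGap d X Y n ω) ≤ lyapSlope ((n : ℝ) + d) (sqGap d X Y n ω) *
      ∑ i, ∑ j, sqGapStep (gap d X Y n ω) i j *
        (piv d δ α (occ d Y n ω) i * piv d δ α (occ d X n ω) j) := by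
  have hn' : (8712 : ℝ) ≤ n := by exact_mod_cast hn
  have hd' : (0 : ℝ) < d := by exact_mod_cast hd
  have hN : (0 : ℝ) < (n : ℝ) + d := by linarith
  obtain ⟨h1, h2⟩ := hV _ hX _ hY (sum_occ hd X n ω) (sum_occ hd Y n ω)
  refine lyapConst_le_slope_mul (by linarith) (sqGap_nonneg X Y n ω) ?_
  rw [sum_sqGapStep_mul (sum_piv hd hδ α _) (sum_piv hd hδ α _)]
  have e1 : sqGap d X Y n ω / ((n : ℝ) + d) =
      ((n : ℝ) + d) * ∑ i, (occ d X n ω i - occ d Y n ω i) ^ 2 := by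
    simp only [sqGap, gap, mul_pow, ← Finset.mul_sum]
    field_simp
  have e2 : ∑ i, gap d X Y n ω i * (piv d δ α (occ d Y n ω) i - piv d δ α (occ d X n ω) i) =
      ((n : ℝ) + d) * ∑ i, (occ d X n ω i - occ d Y n ω i) *
        (piv d δ α (occ d Y n ω) i - piv d δ α (occ d X n ω) i) := by
    simp only [gap, Finset.mul_sum, mul_assoc]
  rw [e1, e2]
  have := mul_le_mul_of_nonneg_left h1 hN.le
  linarith

variable {mΩ : MeasurableSpace Ω} {P : Measure Ω} [IsProbabilityMeasure P]
  {ℱ : Filtration ℕ mΩ} {X Y : ℕ → Ω → Fin d}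

lemma integrable_confined_mul (hX : ∀ n, Measurable[ℱ n] (X n))
    (hY : ∀ n, Measurable[ℱ n] (Y n)) (V : Set (Fin d → ℝ)) (m n : ℕ)
    (F : (Fin d → ℝ) → (Fin d → ℝ) → ℝ) :
    Integrable (fun ω => confined d X Y V m n ω * F (occ d X n ω) (occ d Y n ω)) P :=
  (dependsOnPast_confined_mul X Y V m n F).integrable hX hY

/-- Integrating a function of the past and of the next move of the two walks. -/
lemma integral_next_eq (hX : ∀ n, Measurable[ℱ n] (X n)) (hY : ∀ n, Measurable[ℱ n] (Y n))
    (hcond : ∀ (n : ℕ) (i j : Fin d),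
      (P[(fun ω => (if X (n + 1) ω = i then (1 : ℝ) else 0) *
            (if Y (n + 1) ω = j then (1 : ℝ) else 0)) | ℱ n]) =ᵐ[P]
        fun ω => piv d δ α (occ d Y n ω) i * piv d δ α (occ d X n ω) j)
    {n : ℕ} {f : Fin d → Fin d → Ω → ℝ} (hf : ∀ i j, DependsOnPast X Y n (f i j)) :
    Integrable (fun ω => f (X (n + 1) ω) (Y (n + 1) ω) ω) P ∧
    Integrable (fun ω => ∑ i, ∑ j, f i j ω *
      (piv d δ α (occ d Y n ω) i * piv d δ α (occ d X n ω) j)) P ∧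
    ∫ ω, f (X (n + 1) ω) (Y (n + 1) ω) ω ∂P =
      ∫ ω, ∑ i, ∑ j, f i j ω *
        (piv d δ α (occ d Y n ω) i * piv d δ α (occ d X n ω) j) ∂P := by
  have hsum : ∀ ω, f (X (n + 1) ω) (Y (n + 1) ω) ω = ∑ i, ∑ j, f i j ω *
      ((if X (n + 1) ω = i then (1 : ℝ) else 0) * (if Y (n + 1) ω = j then (1 : ℝ) else 0)) := by
    intro ω
    simp
  have hind : ∀ i j, DependsOnPast X Y (n + 1) (fun ω =>
      (if X (n + 1) ω = i then (1 : ℝ) else 0) * (if Y (n + 1) ω = j then (1 : ℝ) else 0)) := by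
    intro i j ω ω' h
    simp only [(h _ le_rfl).1, (h _ le_rfl).2]
  have hint1 : ∀ i j, Integrable (fun ω => f i j ω *
      ((if X (n + 1) ω = i then (1 : ℝ) else 0) *
        (if Y (n + 1) ω = j then (1 : ℝ) else 0))) P := by
    intro i j
    refine DependsOnPast.integrable hX hY (n := n + 1) fun ω ω' h => ?_
    rw [hf i j ω ω' fun k hk => h k (hk.trans n.le_succ)]
    exact congrArg _ (hind i j ω ω' h)
  have hint2 : ∀ i j, Integrable (fun ω => f i j ω *
      (piv d δ α (occ d Y n ω) i * piv d δ α (occ d X n ω) j)) P := by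
    intro i j
    refine DependsOnPast.integrable hX hY (n := n) fun ω ω' h => ?_
    rw [hf i j ω ω' h, occ_congr fun k hk => (h k hk).1, occ_congr fun k hk => (h k hk).2]
  have hI1 : ∀ i, Integrable (fun ω => ∑ j, f i j ω *
      ((if X (n + 1) ω = i then (1 : ℝ) else 0) *
        (if Y (n + 1) ω = j then (1 : ℝ) else 0))) P :=
    fun i => integrable_finsetSum _ fun j _ => hint1 i j
  have hI2 : ∀ i, Integrable (fun ω => ∑ j, f i j ω *
      (piv d δ α (occ d Y n ω) i * piv d δ α (occ d X n ω) j)) P :=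
    fun i => integrable_finsetSum _ fun j _ => hint2 i j
  simp only [hsum]
  refine ⟨integrable_finsetSum _ fun i _ => hI1 i, integrable_finsetSum _ fun i _ => hI2 i, ?_⟩
  rw [integral_finsetSum _ fun i _ => hI1 i, integral_finsetSum _ fun i _ => hI2 i]
  refine Finset.sum_congr rfl fun i _ => ?_
  rw [integral_finsetSum _ fun j _ => hint1 i j, integral_finsetSum _ fun j _ => hint2 i j]
  refine Finset.sum_congr rfl fun j _ => ?_
  obtain ⟨hm, C, hC⟩ := (hf i j).stronglyMeasurable_and_bounded hX hY
  exact integral_mul_eq_of_condExp_ae_eq (ℱ.le n) hm hC ((hind i j).integrable hX hY)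
    (hcond n i j)

lemma integrable_confined_mul_lyapProc (hX : ∀ n, Measurable[ℱ n] (X n))
    (hY : ∀ n, Measurable[ℱ n] (Y n)) (V : Set (Fin d → ℝ)) (m n : ℕ) :
    Integrable (fun ω => confined d X Y V m n ω * lyapProc d X Y n ω) P :=
  integrable_confined_mul hX hY V m n fun x y =>
    lyap ((n : ℝ) + d) (∑ i, (((n : ℝ) + d) * (x i - y i)) ^ 2) + Real.log (d + 64)

/-- The Lyapunov process killed on leaving a repelling neighbourhood has nonincreasing mean. -/
lemma integral_confined_mul_lyapProc_succ_le (hd : 0 < d) (hδ : 0 < δ) {V : Set (Fin d → ℝ)}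
    (hV : ∀ x ∈ V, ∀ y ∈ V, ∑ i, x i = 1 → ∑ i, y i = 1 →
      ∑ i, (x i - y i) ^ 2 ≤ ∑ i, (x i - y i) * (piv d δ α y i - piv d δ α x i) ∧
      ∑ i, piv d δ α y i * piv d δ α x i ≤ 3 / 4)
    (hX : ∀ n, Measurable[ℱ n] (X n)) (hY : ∀ n, Measurable[ℱ n] (Y n))
    (hcond : ∀ (n : ℕ) (i j : Fin d),
      (P[(fun ω => (if X (n + 1) ω = i then (1 : ℝ) else 0) *
            (if Y (n + 1) ω = j then (1 : ℝ) else 0)) | ℱ n]) =ᵐ[P]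
        fun ω => piv d δ α (occ d Y n ω) i * piv d δ α (occ d X n ω) j)
    {m n : ℕ} (hmn : m ≤ n) (hn : 8712 ≤ n) :
    ∫ ω, confined d X Y V m (n + 1) ω * lyapProc d X Y (n + 1) ω ∂P ≤
      ∫ ω, confined d X Y V m n ω * lyapProc d X Y n ω ∂P := by
  set A : Ω → ℝ := fun ω =>
    confined d X Y V m n ω * lyapConst ((n : ℝ) + d) (sqGap d X Y n ω) with hA
  set f : Fin d → Fin d → Ω → ℝ := fun i j ω => confined d X Y V m n ω *
    (lyapSlope ((n : ℝ) + d) (sqGap d X Y n ω) * sqGapStep (gap d X Y n ω) i j) with hf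
  have hAint : Integrable A P := integrable_confined_mul hX hY V m n fun x y =>
    lyapConst ((n : ℝ) + d) (∑ i, (((n : ℝ) + d) * (x i - y i)) ^ 2)
  have hLint := integrable_confined_mul_lyapProc (P := P) hX hY V m n
  have hfdep : ∀ i j, DependsOnPast X Y n (f i j) := fun i j =>
    dependsOnPast_confined_mul X Y V m n fun x y =>
      lyapSlope ((n : ℝ) + d) (∑ i, (((n : ℝ) + d) * (x i - y i)) ^ 2) *
        sqGapStep (fun i => ((n : ℝ) + d) * (x i - y i)) i j
  obtain ⟨hf1, hf2, hf3⟩ := integral_next_eq hX hY hcond hfdep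
  have hstep : ∀ ω, confined d X Y V m (n + 1) ω * lyapProc d X Y (n + 1) ω ≤
      confined d X Y V m n ω * lyapProc d X Y n ω +
        (A ω - f (X (n + 1) ω) (Y (n + 1) ω) ω) := by
    intro ω
    calc _ ≤ confined d X Y V m n ω * lyapProc d X Y (n + 1) ω :=
          mul_le_mul_of_nonneg_right (confined_succ_le X Y V m n ω)
            (lyapProc_nonneg hd X Y (n + 1) ω)
      _ ≤ confined d X Y V m n ω * _ :=
          mul_le_mul_of_nonneg_left (lyapProc_succ_le hd X Y hn ω)
            (confined_nonneg X Y V m n ω)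
      _ = _ := by simp only [hA, hf]; ring
  have hmean : ∫ ω, A ω ∂P ≤ ∫ ω, f (X (n + 1) ω) (Y (n + 1) ω) ω ∂P := by
    rw [hf3]
    refine integral_mono hAint hf2 fun ω => ?_
    simp only [hA, hf, mul_assoc, ← Finset.mul_sum]
    by_cases h : ∀ k, m ≤ k → k ≤ n → occ d X k ω ∈ V ∧ occ d Y k ω ∈ V
    · exact mul_le_mul_of_nonneg_left (lyapConst_le_mean hd hδ hV X Y hn
        (h n hmn le_rfl).1 (h n hmn le_rfl).2) (confined_nonneg X Y V m n ω)
    · simp [confined, h]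
  refine (integral_mono (integrable_confined_mul_lyapProc hX hY V m (n + 1))
    (hLint.add (hAint.sub hf1)) hstep).trans ?_
  have e := integral_add hLint (hAint.sub hf1)
  have e' := integral_sub hAint hf1
  simp only [Pi.add_apply, Pi.sub_apply] at e e' ⊢
  rw [e, e']
  linarith

end Walk

lemma measure_tendsto_atTop_eq_zero {Ω : Type*} {mΩ : MeasurableSpace Ω} {P : Measure Ω}
    {f : ℕ → Ω → ℝ} (hf : ∀ n, Integrable (f n) P) (hf0 : ∀ n ω, 0 ≤ f n ω) {K : ℝ} {m : ℕ}
    (hK : ∀ n ≥ m, ∫ ω, f n ω ∂P ≤ K) :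
    P {ω | Tendsto (fun n => f n ω) atTop atTop} = 0 := by
  have hmeas : ∀ n, AEMeasurable (fun ω => ENNReal.ofReal (f n ω)) P :=
    fun n => (hf n).aemeasurable.ennreal_ofReal
  have hle : ∫⁻ ω, liminf (fun n => ENNReal.ofReal (f n ω)) atTop ∂P ≤ ENNReal.ofReal K := by
    refine (lintegral_liminf_le' hmeas).trans ?_
    refine liminf_le_of_frequently_le' (Eventually.frequently ?_)
    filter_upwards [eventually_ge_atTop m] with n hn
    rw [← ofReal_integral_eq_lintegral_ofReal (hf n) (ae_of_all _ (hf0 n))]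
    exact ENNReal.ofReal_le_ofReal (hK n hn)
  have hliminf : AEMeasurable (fun ω => liminf (fun n => ENNReal.ofReal (f n ω)) atTop) P := by
    simp only [liminf_eq_iSup_iInf_of_nat']
    exact .iSup fun i => .iInf fun n => hmeas (n + i)
  have hfin := ae_lt_top' hliminf (hle.trans_lt ENNReal.ofReal_lt_top).ne
  refine measure_mono_null (fun ω hω => ?_) (ae_iff.1 hfin)
  have : Tendsto (fun n => ENNReal.ofReal (f n ω)) atTop (nhds ⊤) :=
    ENNReal.tendsto_ofReal_atTop.comp hω
  simp [this.liminf_eq]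

/-- Lemma `nonuniform`: for `d ≥ 2`, `0 < δ < 1/(2d)` and `α > 1`, the
occupation-measure process `z(n)` of the two-particle vertex-reinforced interacting random
walk almost surely does not converge to `(U,U)`, `U = (1/d, …, 1/d)`. -/
theorem stmt_8 (d : ℕ) (hd : 2 ≤ d) (δ : ℝ) (hδ : 0 < δ) (hδ' : δ < 1 / (2 * d))
    (α : ℝ) (hα : 1 < α)
    (Ω : Type) (mΩ : MeasurableSpace Ω) (P : Measure Ω) (hP : IsProbabilityMeasure P)
    (ℱ : Filtration ℕ mΩ) (X Y : ℕ → Ω → Fin d)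
    (hX : ∀ n, Measurable[ℱ n] (X n))
    (hY : ∀ n, Measurable[ℱ n] (Y n))
    (hcond : ∀ (n : ℕ) (i j : Fin d),
      (P[(fun ω => (if X (n + 1) ω = i then (1 : ℝ) else 0) *
            (if Y (n + 1) ω = j then (1 : ℝ) else 0)) | ℱ n]) =ᵐ[P]
        fun ω => piv d δ α (occ d Y n ω) i * piv d δ α (occ d X n ω) j) :
    P {ω | Tendsto (fun n => ((occ d X n ω, occ d Y n ω) :
        (Fin d → ℝ) × (Fin d → ℝ))) atTop
        (nhds ((fun _ => 1 / (d : ℝ)), (fun _ => 1 / (d : ℝ))))} = 0 := by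
  have hd0 : 0 < d := by omega
  have hd' : (0 : ℝ) < d := by exact_mod_cast hd0
  have hδU : δ < 1 / (d : ℝ) :=
    hδ'.trans_le (one_div_le_one_div_of_le hd' (by linarith))
  obtain ⟨V, hVU, hV⟩ := exists_ball_uniform_repelling hd hδ hδU hα
  have hnull : ∀ m : ℕ, P {ω | Tendsto
      (fun n => confined d X Y V m n ω * lyapProc d X Y n ω) atTop atTop} = 0 := by
    intro m
    refine measure_tendsto_atTop_eq_zero (m := max m 8712)
      (K := ∫ ω, confined d X Y V m (max m 8712) ω * lyapProc d X Y (max m 8712) ω ∂P)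
      (integrable_confined_mul_lyapProc hX hY V m)
      (fun n ω => mul_nonneg (confined_nonneg X Y V m n ω) (lyapProc_nonneg hd0 X Y n ω))
      fun n hn => ?_
    induction n, hn using Nat.le_induction with
    | base => exact le_rfl
    | succ n hn ih =>
      exact (integral_confined_mul_lyapProc_succ_le hd0 hδ hV hX hY hcond
        ((le_max_left _ _).trans hn) ((le_max_right _ _).trans hn)).trans ih
  refine measure_mono_null (fun ω hω => ?_) (measure_iUnion_null hnull)
  have hω : Tendsto (fun n => (occ d X n ω, occ d Y n ω)) atTop
      (nhds ((fun _ => 1 / (d : ℝ)), (fun _ => 1 / (d : ℝ)))) := hω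
  have hx : Tendsto (fun n => occ d X n ω) atTop (nhds fun _ => 1 / (d : ℝ)) := hω.fst_nhds
  have hy : Tendsto (fun n => occ d Y n ω) atTop (nhds fun _ => 1 / (d : ℝ)) := hω.snd_nhds
  obtain ⟨m, hm⟩ := eventually_atTop.1 ((hx.eventually hVU).and (hy.eventually hVU))
  refine Set.mem_iUnion.2 ⟨m, ?_⟩
  have hconf : ∀ n, confined d X Y V m n ω = 1 := fun n => if_pos fun k hk _ => hm k hk
  have hN : Tendsto (fun n : ℕ => (n : ℝ) + d) atTop atTop :=
    tendsto_atTop_add_const_right _ _ tendsto_natCast_atTop_atTop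
  have hQ : Tendsto (fun n => sqGap d X Y n ω / ((n : ℝ) + d) ^ 2) atTop (nhds 0) := by
    have h : Tendsto (fun n => ∑ i, (occ d X n ω i - occ d Y n ω i) ^ 2) atTop
        (nhds (∑ _i : Fin d, (1 / (d : ℝ) - 1 / d) ^ 2)) :=
      tendsto_finsetSum _ fun i _ =>
        ((tendsto_pi_nhds.1 hx i).sub (tendsto_pi_nhds.1 hy i)).pow 2
    simp only [sub_self, ne_eq, OfNat.ofNat_ne_zero, not_false_eq_true, zero_pow,
      Finset.sum_const_zero] at h
    refine h.congr fun n => ?_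
    have : (n : ℝ) + d ≠ 0 := by positivity
    simp only [sqGap, gap, mul_pow, ← Finset.mul_sum]
    field_simp
  simp only [Set.mem_ofPred_eq, hconf, one_mul]
  exact tendsto_atTop_add_const_right _ _
    (tendsto_lyap_atTop hN (fun n => sqGap_nonneg X Y n ω) hQ)
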